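/- (First Carleman estimate.) There exist a sufficiently small r₀ > 0 and a sufficiently large β₀ > 1, both depending only on n, and a constant C depending only on n, such that for every u ∈ C₀^∞(ℝⁿ∖{0}) with supp(u) ⊆ B_{r₀} and every β ≥ β₀: β ∫ φ_β² (log|x|)^{−2} |x|^{−n} (|x|²|∇u|² + |u|²) dx ≤ C ∫ φ_β² |x|^{−n} |x|⁴ |Δu|² dx. -/

import Mathlib

open MeasureTheory Real Set

noncomputable section

/-- The `j`-th partial derivative `∂_j f` of a scalar function on `ℝⁿ`. -/
def pdir (n : ℕ) (j : Fin n) (f : EuclideanSpace ℝ (Fin n) → ℝ) :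
    EuclideanSpace ℝ (Fin n) → ℝ :=
  fun x => fderiv ℝ f x (EuclideanSpace.single j 1)

/-- The Laplacian `Δf = Σⱼ ∂ⱼ∂ⱼ f` of a scalar function on `ℝⁿ`. -/
def lapl (n : ℕ) (f : EuclideanSpace ℝ (Fin n) → ℝ)
    (x : EuclideanSpace ℝ (Fin n)) : ℝ :=
  ∑ j, pdir n j (pdir n j f) x

/-- The radial Carleman weight `φ_β(r) = exp(-β ψ(log r))` with
`ψ(t) = t + log t²`, i.e. `φ_β(r) = r^{-β} (log r)^{-2β}` for `0 < r < 1`. -/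
def carlemanWt (β r : ℝ) : ℝ :=
  Real.exp (-β * (Real.log r + Real.log ((Real.log r) ^ 2)))


section helpers
variable {n : ℕ}

lemma pdir_mul' {j : Fin n} {f g : EuclideanSpace ℝ (Fin n) → ℝ} {x : EuclideanSpace ℝ (Fin n)}
    (hf : DifferentiableAt ℝ f x) (hg : DifferentiableAt ℝ g x) :
    pdir n j (fun y => f y * g y) x = pdir n j f x * g x + f x * pdir n j g x := by
  unfold pdir
  rw [fderiv_fun_mul hf hg]
  simp
  ring

lemma pdir_sub' {j : Fin n} {f g : EuclideanSpace ℝ (Fin n) → ℝ} {x : EuclideanSpace ℝ (Fin n)}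
    (hf : DifferentiableAt ℝ f x) (hg : DifferentiableAt ℝ g x) :
    pdir n j (fun y => f y - g y) x = pdir n j f x - pdir n j g x := by
  unfold pdir
  rw [fderiv_fun_sub hf hg]
  simp

lemma pdir_sum' {j : Fin n} {f : Fin n → EuclideanSpace ℝ (Fin n) → ℝ}
    {x : EuclideanSpace ℝ (Fin n)} (hf : ∀ i, DifferentiableAt ℝ (f i) x) :
    pdir n j (fun y => ∑ i, f i y) x = ∑ i, pdir n j (f i) x := by
  unfold pdir
  rw [fderiv_fun_sum (fun i _ => hf i)]
  simp

lemma contDiff_coord (i : Fin n) {k : WithTop ℕ∞} :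
    ContDiff ℝ k (fun y : EuclideanSpace ℝ (Fin n) => y i) :=
  (EuclideanSpace.proj (𝕜 := ℝ) i).contDiff

lemma diff_coord (i : Fin n) (x : EuclideanSpace ℝ (Fin n)) :
    DifferentiableAt ℝ (fun y : EuclideanSpace ℝ (Fin n) => y i) x :=
  (EuclideanSpace.proj (𝕜 := ℝ) i).differentiableAt

lemma pdir_coord (i j : Fin n) (x : EuclideanSpace ℝ (Fin n)) :
    pdir n j (fun y => y i) x = if i = j then 1 else 0 := by
  unfold pdir
  have : fderiv ℝ (fun y : EuclideanSpace ℝ (Fin n) => y i) x = EuclideanSpace.proj (𝕜 := ℝ) i :=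
    (EuclideanSpace.proj (𝕜 := ℝ) i).fderiv
  rw [this]
  simp

lemma contDiff_pdir {j : Fin n} {f : EuclideanSpace ℝ (Fin n) → ℝ}
    (hf : ContDiff ℝ (⊤ : ℕ∞) f) : ContDiff ℝ (⊤ : ℕ∞) (pdir n j f) := by
  unfold pdir
  exact (hf.fderiv_right (m := (⊤ : ℕ∞)) (by simp)).clm_apply contDiff_const

lemma pdir_congr {j : Fin n} {f g : EuclideanSpace ℝ (Fin n) → ℝ} {x : EuclideanSpace ℝ (Fin n)}
    (h : f =ᶠ[nhds x] g) : pdir n j f x = pdir n j g x := by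
  unfold pdir
  rw [h.fderiv_eq]

lemma pdir_comm {i j : Fin n} {f : EuclideanSpace ℝ (Fin n) → ℝ}
    (hf : ContDiff ℝ (⊤ : ℕ∞) f) (x : EuclideanSpace ℝ (Fin n)) :
    pdir n j (pdir n i f) x = pdir n i (pdir n j f) x := by
  have hd : DifferentiableAt ℝ (fderiv ℝ f) x :=
    ((hf.fderiv_right (m := (⊤ : ℕ∞)) (by simp)).differentiable (by simp)).differentiableAt
  have h := (hf.contDiffAt (x := x)).isSymmSndFDerivAt (by simp; exact WithTop.coe_le_coe.2 (le_top (a := (2 : ℕ∞))))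
  unfold pdir
  rw [fderiv_clm_apply hd (by fun_prop), fderiv_clm_apply hd (by fun_prop)]
  simpa using h (EuclideanSpace.single j 1) (EuclideanSpace.single i 1)

lemma norm_fderiv_sq (f : EuclideanSpace ℝ (Fin n) → ℝ) (x : EuclideanSpace ℝ (Fin n)) :
    ‖fderiv ℝ f x‖ ^ 2 = ∑ j, (pdir n j f x) ^ 2 := by
  rw [← (InnerProductSpace.toDual ℝ (EuclideanSpace ℝ (Fin n))).symm.norm_map (fderiv ℝ f x),
    EuclideanSpace.real_norm_sq_eq]
  refine Finset.sum_congr rfl fun j _ => ?_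
  unfold pdir
  rw [← InnerProductSpace.toDual_symm_apply (𝕜 := ℝ), real_inner_comm,
    EuclideanSpace.inner_single_left]
  simp

lemma pdir_zero_off {K : Set (EuclideanSpace ℝ (Fin n))} (hK : IsCompact K) {j : Fin n}
    {f : EuclideanSpace ℝ (Fin n) → ℝ} (hf : ∀ x ∉ K, f x = 0) : ∀ x ∉ K, pdir n j f x = 0 := by
  intro x hx
  have : f =ᶠ[nhds x] fun _ => 0 := by
    filter_upwards [hK.isClosed.isOpen_compl.mem_nhds hx] with y hy using hf y hy
  rw [pdir_congr this]
  simp [pdir]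

/-- log norm is smooth off zero -/
lemma contDiffAt_lognorm {x : EuclideanSpace ℝ (Fin n)} (hx : x ≠ 0) {k : WithTop ℕ∞} :
    ContDiffAt ℝ k (fun y : EuclideanSpace ℝ (Fin n) => Real.log ‖y‖) x :=
  (contDiffAt_norm ℝ hx).log (norm_ne_zero_iff.2 hx)

lemma pdir_lognorm {x : EuclideanSpace ℝ (Fin n)} (hx : x ≠ 0) (j : Fin n) :
    pdir n j (fun y : EuclideanSpace ℝ (Fin n) => Real.log ‖y‖) x = x j / ‖x‖ ^ 2 := by
  have e : (fun y : EuclideanSpace ℝ (Fin n) => Real.log ‖y‖)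
      = fun y => (1/2) * Real.log (‖y‖ ^ 2) := by
    funext y
    rw [Real.log_pow]; push_cast; ring
  have h1 : HasFDerivAt (fun y : EuclideanSpace ℝ (Fin n) => ‖y‖ ^ 2) (2 • innerSL ℝ x) x :=
    (hasStrictFDerivAt_norm_sq x).hasFDerivAt
  have h2 := (h1.log (by simpa using hx)).const_mul (1/2 : ℝ)
  unfold pdir
  rw [e, h2.fderiv]
  simp [EuclideanSpace.inner_single_right]
  field_simp

lemma diffAt_radial {x : EuclideanSpace ℝ (Fin n)} (hx : x ≠ 0) {M : ℝ → ℝ} {M' : ℝ}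
    (hM : HasDerivAt M M' (Real.log ‖x‖)) :
    DifferentiableAt ℝ (fun y : EuclideanSpace ℝ (Fin n) => M (Real.log ‖y‖)) x :=
  hM.differentiableAt.comp x ((contDiffAt_lognorm hx (k := 1)).differentiableAt (by simp))

lemma pdir_radial {x : EuclideanSpace ℝ (Fin n)} (hx : x ≠ 0) (j : Fin n) {M : ℝ → ℝ} {M' : ℝ}
    (hM : HasDerivAt M M' (Real.log ‖x‖)) :
    pdir n j (fun y => M (Real.log ‖y‖)) x = M' / ‖x‖ ^ 2 * x j := by
  have h := hM.comp_hasFDerivAt x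
    ((contDiffAt_lognorm hx (k := 1)).differentiableAt (by simp)).hasFDerivAt
  have h3 := pdir_lognorm hx j
  unfold pdir at h3 ⊢
  have e : fderiv ℝ (fun y : EuclideanSpace ℝ (Fin n) => M (Real.log ‖y‖)) x = _ := h.fderiv
  rw [e]
  simp only [_root_.smul_apply, smul_eq_mul]
  rw [h3]; ring

lemma lognorm_neg {x : EuclideanSpace ℝ (Fin n)} (hx : x ≠ 0) (h1 : ‖x‖ < 1) :
    Real.log ‖x‖ < 0 := Real.log_neg (norm_pos_iff.2 hx) h1

lemma contDiff_radial_mul {K : Set (EuclideanSpace ℝ (Fin n))} (hK : IsCompact K)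
    (hK' : ∀ x ∈ K, x ≠ 0 ∧ ‖x‖ < 1) {k : WithTop ℕ∞} {M : ℝ → ℝ}
    (hM : ContDiffOn ℝ k M (Iio 0)) {h : EuclideanSpace ℝ (Fin n) → ℝ} (hh : ContDiff ℝ k h)
    (h0 : ∀ x ∉ K, h x = 0) : ContDiff ℝ k (fun x => M (Real.log ‖x‖) * h x) := by
  rw [contDiff_iff_contDiffAt]
  intro x
  by_cases hx : x ∈ K
  · obtain ⟨hx0, hx1⟩ := hK' x hx
    have hm : ContDiffAt ℝ k M (Real.log ‖x‖) :=
      hM.contDiffAt (Iio_mem_nhds (lognorm_neg hx0 hx1))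
    exact (hm.comp x (contDiffAt_lognorm hx0)).mul hh.contDiffAt
  · have : (fun x => M (Real.log ‖x‖) * h x) =ᶠ[nhds x] fun _ => 0 := by
      filter_upwards [hK.isClosed.isOpen_compl.mem_nhds hx] with y hy
      rw [h0 y hy, mul_zero]
    exact contDiffAt_const.congr_of_eventuallyEq this

lemma integral_pdir {f : EuclideanSpace ℝ (Fin n) → ℝ} (hf : ContDiff ℝ 1 f)
    (hc : HasCompactSupport f) (j : Fin n) :
    Integrable (pdir n j f) ∧ ∫ x, pdir n j f x = 0 := by
  have hi : Integrable (pdir n j f) := by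
    apply Continuous.integrable_of_hasCompactSupport
    · exact (hf.continuous_fderiv (by simp)).clm_apply continuous_const
    · exact hc.fderiv_apply ℝ _
  refine ⟨hi, ?_⟩
  have := integral_mul_fderiv_eq_neg_fderiv_mul_of_integrable (μ := volume)
    (f := fun _ : EuclideanSpace ℝ (Fin n) => (1:ℝ)) (g := f) (v := EuclideanSpace.single j 1)
    (by simp) (by simp only [one_mul]; exact hi)
    (by simpa using hf.continuous.integrable_of_hasCompactSupport hc)
    (by simp) (fun x _ => (hf.differentiable (by simp)).differentiableAt)
  simpa [pdir] using this

lemma core {K : Set (EuclideanSpace ℝ (Fin n))} (hK : IsCompact K)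
    (hK' : ∀ x ∈ K, x ≠ 0 ∧ ‖x‖ < 1) {M M' : ℝ → ℝ}
    (hM : ContDiffOn ℝ 1 M (Iio 0)) (hM' : ∀ t < 0, HasDerivAt M (M' t) t)
    {h : Fin n → EuclideanSpace ℝ (Fin n) → ℝ} (hh : ∀ j, ContDiff ℝ 1 (h j))
    (h0 : ∀ j, ∀ x ∉ K, h j x = 0)
    {D : EuclideanSpace ℝ (Fin n) → ℝ} (hD0 : ∀ x ∉ K, D x = 0)
    (hD : ∀ x ∈ K, D x = M' (Real.log ‖x‖) / ‖x‖ ^ 2 * (∑ j, x j * h j x)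
      + M (Real.log ‖x‖) * ∑ j, pdir n j (h j) x) :
    Integrable D ∧ ∫ x, D x = 0 := by
  have hF : ∀ j, ContDiff ℝ 1 (fun x => M (Real.log ‖x‖) * h j x) := fun j =>
    contDiff_radial_mul hK hK' hM (hh j) (h0 j)
  have hF0 : ∀ j, ∀ x ∉ K, M (Real.log ‖x‖) * h j x = 0 := fun j x hx => by
    rw [h0 j x hx, mul_zero]
  have hFc : ∀ j, HasCompactSupport (fun x => M (Real.log ‖x‖) * h j x) := fun j =>
    HasCompactSupport.intro hK (hF0 j)
  have e : D = fun x => ∑ j, pdir n j (fun x => M (Real.log ‖x‖) * h j x) x := by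
    funext x
    by_cases hx : x ∈ K
    · obtain ⟨hx0, hx1⟩ := hK' x hx
      have hd := hM' _ (lognorm_neg hx0 hx1)
      rw [hD x hx, Finset.mul_sum, Finset.mul_sum, ← Finset.sum_add_distrib]
      refine Finset.sum_congr rfl fun j _ => ?_
      rw [pdir_mul' (diffAt_radial hx0 hd) ((hh j).differentiable (by simp)).differentiableAt,
        pdir_radial hx0 j hd]
      ring
    · rw [hD0 x hx]
      symm
      exact Finset.sum_eq_zero fun j _ => pdir_zero_off hK (hF0 j) x hx
  rw [e]
  refine ⟨integrable_finsetSum _ fun j _ => (integral_pdir (hF j) (hFc j) j).1, ?_⟩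
  rw [integral_finsetSum _ fun j _ => (integral_pdir (hF j) (hFc j) j).1]
  exact Finset.sum_eq_zero fun j _ => (integral_pdir (hF j) (hFc j) j).2

end helpers

section helpers2
variable {n : ℕ}

lemma divA1 {K : Set (EuclideanSpace ℝ (Fin n))} (hK : IsCompact K)
    (hK' : ∀ x ∈ K, x ≠ 0 ∧ ‖x‖ < 1) {M M' : ℝ → ℝ}
    (hM : ContDiffOn ℝ 1 M (Iio 0)) (hM' : ∀ t < 0, HasDerivAt M (M' t) t)
    {v : EuclideanSpace ℝ (Fin n) → ℝ} (hv : ContDiff ℝ (⊤ : ℕ∞) v) (h0 : ∀ x ∉ K, v x = 0)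
    {D : EuclideanSpace ℝ (Fin n) → ℝ} (hD0 : ∀ x ∉ K, D x = 0)
    (hD : ∀ x ∈ K, D x = M' (Real.log ‖x‖) * v x ^ 2
      + M (Real.log ‖x‖) * (2 * v x * (∑ i, x i * pdir n i v x) + n * v x ^ 2)) :
    Integrable D ∧ ∫ x, D x = 0 := by
  have hv1 : ContDiff ℝ 1 v := hv.of_le (by exact mod_cast le_top)
  have dv : ∀ x, DifferentiableAt ℝ v x := fun x => (hv1.differentiable (by simp)).differentiableAt
  refine core hK hK' hM hM' (h := fun j x => x j * (v x * v x))
    (fun j => (contDiff_coord j).mul (hv1.mul hv1))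
    (fun j x hx => by simp [h0 x hx]) hD0 ?_
  intro x hx
  rw [hD x hx]
  have hx0 : ‖x‖ ^ 2 ≠ 0 := by simpa using (hK' x hx).1
  have e1 : ∑ j, x j * (x j * (v x * v x)) = ‖x‖ ^ 2 * v x ^ 2 := by
    rw [EuclideanSpace.real_norm_sq_eq, Finset.sum_mul]
    exact Finset.sum_congr rfl fun j _ => by ring
  have e2 : ∀ j : Fin n, pdir n j (fun x => x j * (v x * v x)) x
      = v x ^ 2 + 2 * v x * (x j * pdir n j v x) := by
    intro j
    rw [pdir_mul' (diff_coord j x) ((dv x).fun_mul (dv x)), pdir_mul' (dv x) (dv x), pdir_coord]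
    simp; ring
  simp only [e1, e2]
  rw [Finset.sum_add_distrib, ← Finset.mul_sum]
  have hx1 : ‖x‖ ≠ 0 := by simpa using (hK' x hx).1
  rw [show M' (Real.log ‖x‖) / ‖x‖ ^ 2 * (‖x‖ ^ 2 * v x ^ 2) = M' (Real.log ‖x‖) * v x ^ 2 by
    field_simp]
  simp only [Finset.sum_const, Finset.card_univ, Fintype.card_fin, nsmul_eq_mul]
  ring

lemma divA3 {K : Set (EuclideanSpace ℝ (Fin n))} (hK : IsCompact K)
    (hK' : ∀ x ∈ K, x ≠ 0 ∧ ‖x‖ < 1) {M M' : ℝ → ℝ}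
    (hM : ContDiffOn ℝ 1 M (Iio 0)) (hM' : ∀ t < 0, HasDerivAt M (M' t) t)
    {v : EuclideanSpace ℝ (Fin n) → ℝ} (hv : ContDiff ℝ (⊤ : ℕ∞) v) (h0 : ∀ x ∉ K, v x = 0)
    {D : EuclideanSpace ℝ (Fin n) → ℝ} (hD0 : ∀ x ∉ K, D x = 0)
    (hD : ∀ x ∈ K, D x = M' (Real.log ‖x‖) / ‖x‖ ^ 2 * (v x * (∑ i, x i * pdir n i v x))
      + M (Real.log ‖x‖) * (v x * lapl n v x + ∑ i, pdir n i v x ^ 2)) :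
    Integrable D ∧ ∫ x, D x = 0 := by
  have hv1 : ContDiff ℝ 1 v := hv.of_le (by exact mod_cast le_top)
  have dv : ∀ x, DifferentiableAt ℝ v x := fun x => (hv1.differentiable (by simp)).differentiableAt
  have hp : ∀ j, ContDiff ℝ 1 (pdir n j v) := fun j =>
    (contDiff_pdir hv).of_le (by exact mod_cast le_top)
  have dp : ∀ j x, DifferentiableAt ℝ (pdir n j v) x := fun j x =>
    ((hp j).differentiable (by simp)).differentiableAt
  refine core hK hK' hM hM' (h := fun j x => v x * pdir n j v x)
    (fun j => hv1.mul (hp j))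
    (fun j x hx => by simp [h0 x hx]) hD0 ?_
  intro x hx
  rw [hD x hx]
  have e2 : ∀ j : Fin n, pdir n j (fun x => v x * pdir n j v x) x
      = v x * pdir n j (pdir n j v) x + pdir n j v x ^ 2 := by
    intro j
    rw [pdir_mul' (dv x) (dp j x)]
    ring
  simp only [e2, lapl]
  rw [Finset.sum_add_distrib, ← Finset.mul_sum, Finset.mul_sum (a := v x) (f := fun i => x i * pdir n i v x)]
  congr 2
  exact Finset.sum_congr rfl fun j _ => by ring

lemma divA2 {K : Set (EuclideanSpace ℝ (Fin n))} (hK : IsCompact K)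
    (hK' : ∀ x ∈ K, x ≠ 0 ∧ ‖x‖ < 1) {M M' : ℝ → ℝ}
    (hM : ContDiffOn ℝ 1 M (Iio 0)) (hM' : ∀ t < 0, HasDerivAt M (M' t) t)
    {v : EuclideanSpace ℝ (Fin n) → ℝ} (hv : ContDiff ℝ (⊤ : ℕ∞) v) (h0 : ∀ x ∉ K, v x = 0)
    {D : EuclideanSpace ℝ (Fin n) → ℝ} (hD0 : ∀ x ∉ K, D x = 0)
    (hD : ∀ x ∈ K, D x = M' (Real.log ‖x‖) / ‖x‖ ^ 2 * (2 * (∑ i, x i * pdir n i v x) ^ 2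
        - ‖x‖ ^ 2 * ∑ i, pdir n i v x ^ 2)
      + M (Real.log ‖x‖) * (2 * (∑ i, x i * pdir n i v x) * lapl n v x
        + (2 - n) * ∑ i, pdir n i v x ^ 2)) :
    Integrable D ∧ ∫ x, D x = 0 := by
  have hp : ∀ j, ContDiff ℝ 1 (pdir n j v) := fun j =>
    (contDiff_pdir hv).of_le (by exact mod_cast le_top)
  have dp : ∀ j x, DifferentiableAt ℝ (pdir n j v) x := fun j x =>
    ((hp j).differentiable (by simp)).differentiableAt
  have he : ContDiff ℝ 1 (fun x : EuclideanSpace ℝ (Fin n) => ∑ i, x i * pdir n i v x) :=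
    ContDiff.sum fun i _ => (contDiff_coord i).mul (hp i)
  have hg : ContDiff ℝ 1 (fun x : EuclideanSpace ℝ (Fin n) => ∑ i, pdir n i v x * pdir n i v x) :=
    ContDiff.sum fun i _ => (hp i).mul (hp i)
  have de : ∀ x, DifferentiableAt ℝ (fun x : EuclideanSpace ℝ (Fin n) => ∑ i, x i * pdir n i v x) x :=
    fun x => (he.differentiable (by simp)).differentiableAt
  have dg : ∀ x, DifferentiableAt ℝ
      (fun x : EuclideanSpace ℝ (Fin n) => ∑ i, pdir n i v x * pdir n i v x) x :=
    fun x => (hg.differentiable (by simp)).differentiableAt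
  refine core hK hK' hM hM' (h := fun j x => (2 * pdir n j v x) * (∑ i, x i * pdir n i v x)
      - x j * ∑ i, pdir n i v x * pdir n i v x)
    (fun j => ((contDiff_const.mul (hp j)).mul he).sub ((contDiff_coord j).mul hg))
    (fun j x hx => by simp [pdir_zero_off hK h0 x hx]) hD0 ?_
  intro x hx
  rw [hD x hx]
  have e1 : ∀ j, pdir n j (fun x => ∑ i, x i * pdir n i v x) x
      = pdir n j v x + ∑ i, x i * pdir n j (pdir n i v) x := by
    intro j
    rw [pdir_sum' fun i => (diff_coord i x).fun_mul (dp i x)]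
    simp only [pdir_mul' (diff_coord _ x) (dp _ x), pdir_coord]
    rw [Finset.sum_add_distrib]
    simp
  have e2 : ∀ j, pdir n j (fun x => ∑ i, pdir n i v x * pdir n i v x) x
      = 2 * ∑ i, pdir n i v x * pdir n j (pdir n i v) x := by
    intro j
    rw [pdir_sum' fun i => (dp i x).fun_mul (dp i x), Finset.mul_sum]
    simp only [pdir_mul' (dp _ x) (dp _ x)]
    exact Finset.sum_congr rfl fun i _ => by ring
  have e3 : ∀ j, pdir n j (fun x => 2 * pdir n j v x) x = 2 * pdir n j (pdir n j v) x := by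
    intro j
    rw [pdir_mul' (by fun_prop) (dp j x)]
    simp [pdir]
  have e4 : ∀ j, pdir n j (fun x => (2 * pdir n j v x) * (∑ i, x i * pdir n i v x)
      - x j * ∑ i, pdir n i v x * pdir n i v x) x
      = 2 * (∑ i, x i * pdir n i v x) * pdir n j (pdir n j v) x
        + 2 * pdir n j v x ^ 2
        + 2 * (∑ i, pdir n j v x * (x i * pdir n j (pdir n i v) x))
        - (∑ i, pdir n i v x ^ 2)
        - 2 * (∑ i, x j * (pdir n i v x * pdir n j (pdir n i v) x)) := by
    intro j
    rw [pdir_sub' (((dp j x).const_mul 2).fun_mul (de x)) ((diff_coord j x).fun_mul (dg x)),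
      pdir_mul' ((dp j x).const_mul 2) (de x), pdir_mul' (diff_coord j x) (dg x), e1, e2, e3,
      pdir_coord, ← Finset.mul_sum, ← Finset.mul_sum]
    simp only [← pow_two]
    simp
    ring
  have e5 : ∑ j, ∑ i, pdir n j v x * (x i * pdir n j (pdir n i v) x)
      = ∑ j, ∑ i, x j * (pdir n i v x * pdir n j (pdir n i v) x) := by
    rw [Finset.sum_comm]
    refine Finset.sum_congr rfl fun j _ => Finset.sum_congr rfl fun i _ => ?_
    rw [pdir_comm hv x]; ring
  have e6 : ∑ j, x j * ((2 * pdir n j v x) * (∑ i, x i * pdir n i v x)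
      - x j * ∑ i, pdir n i v x * pdir n i v x) = 2 * (∑ i, x i * pdir n i v x) ^ 2
        - ‖x‖ ^ 2 * ∑ i, pdir n i v x ^ 2 := by
    simp only [← pow_two, mul_sub, Finset.sum_sub_distrib]
    rw [EuclideanSpace.real_norm_sq_eq, Finset.sum_mul]
    congr 1
    · rw [pow_two, ← mul_assoc, Finset.mul_sum _ _ (2 * _)]
      exact Finset.sum_congr rfl fun i _ => by ring
    · exact Finset.sum_congr rfl fun i _ => by ring
  simp only [← Finset.mul_sum] at e5
  simp only [e4, e6, Finset.sum_sub_distrib, Finset.sum_add_distrib, ← Finset.mul_sum, e5, lapl]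
  simp only [Finset.sum_const, Finset.card_univ, Fintype.card_fin, nsmul_eq_mul]
  ring

end helpers2

section helpers3
variable {n : ℕ}

/-- radial weight in logarithmic variable -/
def PhiW (β t : ℝ) : ℝ := Real.exp (-β * (t + Real.log (t ^ 2)))

lemma hs_deriv {t : ℝ} (ht : t < 0) : HasDerivAt (fun t : ℝ => t⁻¹) (-(t⁻¹ ^ 2)) t := by
  simpa using hasDerivAt_inv ht.ne

lemma Phi_deriv (β : ℝ) {t : ℝ} (ht : t < 0) :
    HasDerivAt (PhiW β) (-(β * (1 + 2 * t⁻¹)) * PhiW β t) t := by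
  have h2 : HasDerivAt (fun t : ℝ => t ^ 2) (2 * t) t := by simpa using hasDerivAt_pow 2 t
  have h := (((hasDerivAt_id t).add (h2.log (by simpa using ht.ne))).const_mul (-β)).exp
  refine h.congr_deriv ?_
  have := ht.ne
  simp only [PhiW, Pi.add_apply, id]
  field_simp

lemma Phi_smooth (β : ℝ) {k : WithTop ℕ∞} : ContDiffOn ℝ k (PhiW β) (Iio 0) := by
  unfold PhiW
  intro t ht
  have ht' : t ≠ 0 := (ne_of_lt ht)
  refine ContDiffAt.contDiffWithinAt ?_
  have : t ^ 2 ≠ 0 := by simpa using ht'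
  fun_prop (disch := assumption)

lemma exp_deriv (k t : ℝ) : HasDerivAt (fun t : ℝ => Real.exp (k * t)) (k * Real.exp (k * t)) t := by
  have := ((hasDerivAt_id t).const_mul k).exp
  refine this.congr_deriv ?_
  simp; ring

lemma exp_log_norm {x : EuclideanSpace ℝ (Fin n)} (hx : x ≠ 0) (k : ℕ) :
    Real.exp (-(k:ℝ) * Real.log ‖x‖) = (‖x‖ ^ k)⁻¹ := by
  have : 0 < ‖x‖ := norm_pos_iff.2 hx
  rw [neg_mul, Real.exp_neg, ← Real.log_pow, Real.exp_log (by positivity)]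

lemma exp_log_norm' {x : EuclideanSpace ℝ (Fin n)} (hx : x ≠ 0) (k : ℕ) :
    Real.exp ((2 - (k:ℝ)) * Real.log ‖x‖) = ‖x‖ ^ 2 * (‖x‖ ^ k)⁻¹ := by
  have h : 0 < ‖x‖ := norm_pos_iff.2 hx
  rw [sub_mul, sub_eq_add_neg, Real.exp_add, ← neg_mul, exp_log_norm hx]
  congr 1
  rw [show (2:ℝ) * Real.log ‖x‖ = Real.log (‖x‖ ^ 2) by rw [Real.log_pow]; norm_num,
    Real.exp_log (by positivity)]

lemma conj1 {β : ℝ} {u : EuclideanSpace ℝ (Fin n) → ℝ} (hu : ContDiff ℝ (⊤ : ℕ∞) u)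
    {x : EuclideanSpace ℝ (Fin n)} (hx : x ≠ 0) (hx1 : ‖x‖ < 1) (j : Fin n) :
    pdir n j (fun x => PhiW β (Real.log ‖x‖) * u x) x
      = PhiW β (Real.log ‖x‖) *
        (pdir n j u x - β * (1 + 2 * (Real.log ‖x‖)⁻¹) / ‖x‖ ^ 2 * x j * u x) := by
  have hd := Phi_deriv β (lognorm_neg hx hx1)
  rw [pdir_mul' (diffAt_radial hx hd) ((hu.differentiable (by simp)).differentiableAt),
    pdir_radial hx j hd]
  ring

lemma conj2 {β : ℝ} {u : EuclideanSpace ℝ (Fin n) → ℝ} (hu : ContDiff ℝ (⊤ : ℕ∞) u)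
    {x : EuclideanSpace ℝ (Fin n)} (hx : x ≠ 0) (hx1 : ‖x‖ < 1) :
    ‖x‖ ^ 2 * lapl n (fun x => PhiW β (Real.log ‖x‖) * u x) x
      = PhiW β (Real.log ‖x‖) * (‖x‖ ^ 2 * lapl n u x
        - 2 * (β * (1 + 2 * (Real.log ‖x‖)⁻¹)) * (∑ j, x j * pdir n j u x)
        + ((β * (1 + 2 * (Real.log ‖x‖)⁻¹)) ^ 2 + 2 * β * (Real.log ‖x‖)⁻¹ ^ 2
          - (n - 2) * (β * (1 + 2 * (Real.log ‖x‖)⁻¹))) * u x) := by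
  have ht := lognorm_neg hx hx1
  have hd := Phi_deriv β ht
  have hnx : 0 < ‖x‖ := norm_pos_iff.2 hx
  set t := Real.log ‖x‖ with htdef
  have du : ∀ x, DifferentiableAt ℝ u x := fun x => (hu.differentiable (by simp)).differentiableAt
  have dp : ∀ j x, DifferentiableAt ℝ (pdir n j u) x := fun j x =>
    ((contDiff_pdir hu).differentiable (by simp)).differentiableAt
  -- auxiliary radial function
  have hW : HasDerivAt (fun t : ℝ => Real.exp ((-2) * t) * ((-β * (1 + 2 * t⁻¹)) * PhiW β t))
      (Real.exp ((-2) * t) * (2 * β * t⁻¹ ^ 2 + (β * (1 + 2 * t⁻¹)) ^ 2 + 2 * (β * (1 + 2 * t⁻¹)))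
        * PhiW β t) t := by
    have := (exp_deriv (-2) t).mul
      (((((hs_deriv ht).const_mul 2).const_add 1).const_mul (-β)).mul hd)
    refine this.congr_deriv ?_
    simp only [Pi.mul_apply]
    ring
  have hev : ∀ j, pdir n j (fun x => PhiW β (Real.log ‖x‖) * u x) =ᶠ[nhds x] fun y =>
      (fun t : ℝ => Real.exp ((-2) * t) * ((-β * (1 + 2 * t⁻¹)) * PhiW β t)) (Real.log ‖y‖)
        * (y j * u y) + PhiW β (Real.log ‖y‖) * pdir n j u y := by
    intro j
    have o1 : ∀ᶠ y in nhds x, y ≠ 0 := isOpen_ne.mem_nhds hx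
    have o2 : ∀ᶠ y : EuclideanSpace ℝ (Fin n) in nhds x, ‖y‖ < 1 :=
      (isOpen_lt continuous_norm continuous_const).mem_nhds hx1
    filter_upwards [o1, o2] with y hy hy1
    rw [conj1 hu hy hy1]
    have := exp_log_norm hy 2
    norm_num at this
    simp only [neg_mul, this]
    ring
  have hpp : ∀ j, pdir n j (pdir n j (fun x => PhiW β (Real.log ‖x‖) * u x)) x
      = Real.exp ((-2) * t) * PhiW β t *
        ((2 * β * t⁻¹ ^ 2 + (β * (1 + 2 * t⁻¹)) ^ 2 + 2 * (β * (1 + 2 * t⁻¹))) * u x / ‖x‖ ^ 2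
          * (x j ^ 2) - (β * (1 + 2 * t⁻¹)) * u x
          - (β * (1 + 2 * t⁻¹)) * (x j * pdir n j u x))
        + PhiW β t * (- (β * (1 + 2 * t⁻¹)) / ‖x‖ ^ 2 * (x j * pdir n j u x)
          + pdir n j (pdir n j u) x) := by
    intro j
    rw [pdir_congr (hev j)]
    have hadd : ∀ {f g : EuclideanSpace ℝ (Fin n) → ℝ}, DifferentiableAt ℝ f x →
        DifferentiableAt ℝ g x →
        pdir n j (fun y => f y + g y) x = pdir n j f x + pdir n j g x := by
      intro f g hf hg
      unfold pdir
      rw [fderiv_fun_add hf hg]; simp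
    rw [hadd ((diffAt_radial hx hW).fun_mul ((diff_coord j x).fun_mul (du x)))
      ((diffAt_radial hx hd).fun_mul (dp j x)),
      pdir_mul' (diffAt_radial hx hW) ((diff_coord j x).fun_mul (du x)),
      pdir_mul' (diffAt_radial hx hd) (dp j x), pdir_mul' (diff_coord j x) (du x),
      pdir_radial hx j hW, pdir_radial hx j hd, pdir_coord]
    simp only [← htdef, if_true]
    ring
  simp only [lapl, hpp]
  rw [Finset.sum_add_distrib, ← Finset.mul_sum, ← Finset.mul_sum, Finset.sum_sub_distrib,
    Finset.sum_sub_distrib, Finset.sum_add_distrib, ← Finset.mul_sum, ← Finset.mul_sum,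
    ← Finset.mul_sum, ← Finset.mul_sum, ← EuclideanSpace.real_norm_sq_eq]
  have := exp_log_norm hx 2
  rw [← htdef] at this
  norm_num at this
  simp only [neg_mul, this]
  simp only [Finset.sum_const, Finset.card_univ, Fintype.card_fin, nsmul_eq_mul]
  field_simp
  ring

lemma alg {β s N G e v X : ℝ} (hβ : 2 ≤ β) (hs : -(1/8) ≤ s) (hs0 : s < 0) (hN : 0 ≤ N)
    (hG : e ^ 2 ≤ G) {κ a b a' c' : ℝ} (hκ : κ = β * (1 + 2 * s)) (ha : a = 2 * κ + N)
    (hb : b = κ ^ 2 - 2 * β * s ^ 2 + N * κ) (ha' : a' = -4 * β * s ^ 2)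
    (hc' : c' = a' * b + a * (2 * κ * (-2 * β * s ^ 2) + 4 * β * s ^ 3 + N * (-2 * β * s ^ 2))) :
    β * s ^ 2 * ((G + 2 * κ * v * e + κ ^ 2 * v ^ 2) + v ^ 2) ≤
      3 * ((X + 2 * κ * e + b * v) ^ 2
        - (2 * a * e * (X - N * e) + 2 * a' * e ^ 2 - a' * G)
        - (c' * v ^ 2 + 2 * (a * b) * v * e)
        - ((-8 * β * s ^ 2) * (v * X + G) + (-N * (-8 * β * s ^ 2) + 16 * β * s ^ 3) * v * e)) := by
  have hid : (X + 2 * κ * e + b * v) ^ 2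
        - (2 * a * e * (X - N * e) + 2 * a' * e ^ 2 - a' * G)
        - (c' * v ^ 2 + 2 * (a * b) * v * e)
        - ((-8 * β * s ^ 2) * (v * X + G) + (-N * (-8 * β * s ^ 2) + 16 * β * s ^ 3) * v * e)
      = (X - N * e + b * v + 4 * β * s ^ 2 * v) ^ 2 + (a ^ 2 - 2 * a') * e ^ 2
        + (4 * β * s ^ 2) * G
        + (- c' - 8 * β * s ^ 2 * b - 16 * β ^ 2 * s ^ 4) * v ^ 2 - 16 * β * s ^ 3 * v * e := by
    rw [ha, ha']; ring
  rw [hid]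
  have hκ1 : 3 / 4 * β ≤ κ := by rw [hκ]; nlinarith
  have hκ2 : κ ≤ β := by rw [hκ]; nlinarith
  have hs2 : s ^ 2 ≤ 1 / 64 := by nlinarith
  have hs2' : 0 ≤ s ^ 2 := sq_nonneg s
  -- coefficient of v ^ 2
  have hcoef : - c' - 8 * β * s ^ 2 * b - 16 * β ^ 2 * s ^ 4
      = s ^ 2 * (4 * β * κ ^ 2 - 16 * β ^ 2 * s ^ 2 + 8 * β ^ 2 * s ^ 2
        + (-s) * (4 * β * a) + N * (4 * β * κ + 2 * β * N)  - 0) := by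
    rw [hc', ha', hb, ha]; ring
  have ha0 : 2 * κ ≤ a := by rw [ha]; linarith
  have hβ3 : 2 * β ^ 2 ≤ β ^ 3 := by
    have := mul_le_mul_of_nonneg_right hβ (sq_nonneg β)
    linarith [show β * β ^ 2 = β ^ 3 by ring]
  have hκs : 9 / 16 * β ^ 2 ≤ κ ^ 2 := by
    have := pow_le_pow_left₀ (by linarith) hκ1 2
    linarith [show (3 / 4 * β) ^ 2 = 9 / 16 * β ^ 2 by ring]
  have hκs2 : κ ^ 2 ≤ β ^ 2 := pow_le_pow_left₀ (by linarith) hκ2 2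
  have h1 : 9 / 4 * β ^ 3 ≤ 4 * β * κ ^ 2 := by
    have := mul_le_mul_of_nonneg_left hκs (show 0 ≤ 4 * β by linarith)
    linarith [show 4 * β * (9 / 16 * β ^ 2) = 9 / 4 * β ^ 3 by ring]
  have h2 : β ^ 2 * s ^ 2 ≤ β ^ 2 * (1 / 64) := by gcongr
  have h3 : 0 ≤ (-s) * (4 * β * a) := by
    have : 0 ≤ a := by linarith
    have : 0 ≤ -s := by linarith
    positivity
  have h4 : 0 ≤ N * (4 * β * κ + 2 * β * N) := by
    have : 0 ≤ κ := by linarith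
    positivity
  have hco : 2 * β ^ 3 * s ^ 2 ≤ - c' - 8 * β * s ^ 2 * b - 16 * β ^ 2 * s ^ 4 := by
    rw [hcoef, mul_comm]
    gcongr
    linarith
  have hco' := mul_le_mul_of_nonneg_right hco (sq_nonneg v)
  have hae : β ^ 2 ≤ a ^ 2 - 2 * a' := by
    have : 0 ≤ -a' := by
      have : 0 ≤ 4 * β * s ^ 2 := by positivity
      rw [ha']; linarith
    have : (3 / 2 * β) ^ 2 ≤ a ^ 2 := by
      apply pow_le_pow_left₀ <;> linarith
    linarith [show (3 / 2 * β) ^ 2 = 9 / 4 * β ^ 2 by ring, sq_nonneg β]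
  have hae' := mul_le_mul_of_nonneg_right hae (sq_nonneg e)
  have hcross : 16 * β * s ^ 3 * v * e ≤ β ^ 2 * e ^ 2 + 64 * s ^ 6 * v ^ 2 := by
    linarith [sq_nonneg (β * e - 8 * s ^ 3 * v), show (β * e - 8 * s ^ 3 * v) ^ 2
      = β ^ 2 * e ^ 2 + 64 * s ^ 6 * v ^ 2 - 16 * β * s ^ 3 * v * e by ring]
  have hs6 : 64 * s ^ 6 ≤ s ^ 2 := by
    have h := pow_le_pow_left₀ hs2' hs2 2
    have h' := mul_le_mul_of_nonneg_right h hs2'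
    linarith [show (s ^ 2) ^ 2 * s ^ 2 = s ^ 6 by ring]
  have hs6' := mul_le_mul_of_nonneg_right hs6 (sq_nonneg v)
  have hL : G + 2 * κ * v * e + κ ^ 2 * v ^ 2 + v ^ 2 ≤ 2 * G + (2 * β ^ 2 + 1) * v ^ 2 := by
    have q1 : κ ^ 2 * v ^ 2 ≤ β ^ 2 * v ^ 2 := by gcongr
    linarith [sq_nonneg (κ * v - e), show (κ * v - e) ^ 2
      = κ ^ 2 * v ^ 2 - 2 * κ * v * e + e ^ 2 by ring]
  have hL' : β * s ^ 2 * (G + 2 * κ * v * e + κ ^ 2 * v ^ 2 + v ^ 2)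
      ≤ β * s ^ 2 * (2 * G + (2 * β ^ 2 + 1) * v ^ 2) := by gcongr
  have hGG : 0 ≤ β * s ^ 2 * G := by
    have : 0 ≤ G := le_trans (sq_nonneg e) hG
    positivity
  have hf : (β + 3) * (s ^ 2 * v ^ 2) ≤ 4 * β ^ 3 * (s ^ 2 * v ^ 2) := by
    gcongr
    have : (2:ℝ) ^ 2 ≤ β ^ 2 := by gcongr
    have : 2 * 2 ^ 2 ≤ β ^ 3 := by linarith
    have : β * 2 ≤ β * β := by gcongr
    linarith [show β * β = β ^ 2 by ring]
  have := sq_nonneg (X - N * e + b * v + 4 * β * s ^ 2 * v)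
  have hexp : β * s ^ 2 * (2 * G + (2 * β ^ 2 + 1) * v ^ 2)
      = 2 * (β * s ^ 2 * G) + 2 * β ^ 3 * s ^ 2 * v ^ 2 + β * (s ^ 2 * v ^ 2) := by ring
  linarith [show (β + 3) * (s ^ 2 * v ^ 2) = β * (s ^ 2 * v ^ 2) + 3 * (s ^ 2 * v ^ 2) by ring]

end helpers3

section helpers4
variable {n : ℕ}

def kapF (β t : ℝ) : ℝ := β * (1 + 2 * t⁻¹)
def aF (N β t : ℝ) : ℝ := 2 * kapF β t + N
def bF (N β t : ℝ) : ℝ := kapF β t ^ 2 - 2 * β * t⁻¹ ^ 2 + N * kapF β t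
def cF' (N β t : ℝ) : ℝ := (-4 * β * t⁻¹ ^ 2) * bF N β t + aF N β t *
  (2 * kapF β t * (-2 * β * t⁻¹ ^ 2) + 4 * β * t⁻¹ ^ 3 + N * (-2 * β * t⁻¹ ^ 2))

lemma kapF_deriv (β : ℝ) {t : ℝ} (ht : t < 0) :
    HasDerivAt (kapF β) (-2 * β * t⁻¹ ^ 2) t := by
  have := (((hs_deriv ht).const_mul 2).const_add 1).const_mul β
  exact this.congr_deriv (by ring)

lemma aF_deriv (N β : ℝ) {t : ℝ} (ht : t < 0) :
    HasDerivAt (aF N β) (-4 * β * t⁻¹ ^ 2) t := by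
  have := ((kapF_deriv β ht).const_mul 2).add_const N
  exact this.congr_deriv (by ring)

lemma ssq_deriv {t : ℝ} (ht : t < 0) :
    HasDerivAt (fun t : ℝ => t⁻¹ ^ 2) (-2 * t⁻¹ ^ 3) t := by
  have := (hs_deriv ht).pow 2
  exact this.congr_deriv (by simp; ring)

lemma bF_deriv (N β : ℝ) {t : ℝ} (ht : t < 0) :
    HasDerivAt (bF N β)
      (2 * kapF β t * (-2 * β * t⁻¹ ^ 2) + 4 * β * t⁻¹ ^ 3 + N * (-2 * β * t⁻¹ ^ 2)) t := by
  have := (((kapF_deriv β ht).pow 2).sub ((ssq_deriv ht).const_mul (2 * β))).add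
    ((kapF_deriv β ht).const_mul N)
  exact this.congr_deriv (by simp; ring)

lemma inv_smooth {k : WithTop ℕ∞} : ContDiffOn ℝ k (fun t : ℝ => t⁻¹) (Iio 0) :=
  contDiffOn_id.inv fun _ ht => ne_of_lt ht

lemma kapF_smooth (β : ℝ) {k : WithTop ℕ∞} : ContDiffOn ℝ k (kapF β) (Iio 0) :=
  contDiffOn_const.mul (contDiffOn_const.add (contDiffOn_const.mul inv_smooth))

lemma aF_smooth (N β : ℝ) {k : WithTop ℕ∞} : ContDiffOn ℝ k (aF N β) (Iio 0) :=
  (contDiffOn_const.mul (kapF_smooth β)).add contDiffOn_const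

lemma bF_smooth (N β : ℝ) {k : WithTop ℕ∞} : ContDiffOn ℝ k (bF N β) (Iio 0) :=
  (((kapF_smooth β).pow 2).sub (contDiffOn_const.mul (inv_smooth.pow 2))).add
    (contDiffOn_const.mul (kapF_smooth β))

lemma exp_smooth (c : ℝ) {k : WithTop ℕ∞} :
    ContDiffOn ℝ k (fun t : ℝ => Real.exp (c * t)) (Iio 0) := by
  apply ContDiff.contDiffOn
  fun_prop

lemma main_est (hn : 2 ≤ n) {u : EuclideanSpace ℝ (Fin n) → ℝ}
    (hu : ContDiff ℝ (⊤ : ℕ∞) u) (hc : HasCompactSupport u)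
    (hb : tsupport u ⊆ Metric.ball (0 : EuclideanSpace ℝ (Fin n)) (Real.exp (-8)))
    (h0 : (0 : EuclideanSpace ℝ (Fin n)) ∉ tsupport u) {β : ℝ} (hβ : 2 ≤ β) :
    β * ∫ x : EuclideanSpace ℝ (Fin n),
            (carlemanWt β ‖x‖) ^ 2 * ((Real.log ‖x‖) ^ 2)⁻¹ * (‖x‖ ^ n)⁻¹ *
              (‖x‖ ^ 2 * ‖fderiv ℝ u x‖ ^ 2 + (u x) ^ 2) ≤
        3 * ∫ x : EuclideanSpace ℝ (Fin n),
            (carlemanWt β ‖x‖) ^ 2 * (‖x‖ ^ n)⁻¹ * ‖x‖ ^ 4 * (lapl n u x) ^ 2 := by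
  have hwt : ∀ r, carlemanWt β r = PhiW β (Real.log r) := fun r => rfl
  simp only [hwt]
  set K := tsupport u with hKdef
  have hK : IsCompact K := hc
  have hKt : ∀ x ∈ K, x ≠ 0 ∧ ‖x‖ < Real.exp (-8) := fun x hx =>
    ⟨fun h => h0 (h ▸ hx), by simpa using hb hx⟩
  have hK' : ∀ x ∈ K, x ≠ 0 ∧ ‖x‖ < 1 := fun x hx =>
    ⟨(hKt x hx).1, (hKt x hx).2.trans (by rw [Real.exp_lt_one_iff]; norm_num)⟩
  have hu0 : ∀ x ∉ K, u x = 0 := fun x hx => image_eq_zero_of_notMem_tsupport hx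
  set v : EuclideanSpace ℝ (Fin n) → ℝ := fun x => PhiW β (Real.log ‖x‖) * u x with hvdef
  have hv : ContDiff ℝ (⊤ : ℕ∞) v := contDiff_radial_mul hK hK' (Phi_smooth β) hu hu0
  have hv0 : ∀ x ∉ K, v x = 0 := fun x hx => by simp [hvdef, hu0 x hx]
  have hp0 : ∀ j, ∀ x ∉ K, pdir n j v x = 0 := fun j => pdir_zero_off hK hv0
  set N : ℝ := (n:ℝ) - 2 with hN
  have hN0 : 0 ≤ N := by
    have : (2:ℝ) ≤ n := by exact_mod_cast hn
    linarith
  let e : EuclideanSpace ℝ (Fin n) → ℝ := fun x => ∑ i, x i * pdir n i v x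
  let G : EuclideanSpace ℝ (Fin n) → ℝ := fun x => ‖x‖ ^ 2 * ∑ i, pdir n i v x ^ 2
  let X : EuclideanSpace ℝ (Fin n) → ℝ := fun x => ‖x‖ ^ 2 * lapl n v x
  have he0 : ∀ x ∉ K, e x = 0 := fun x hx => by simp [e, hp0 _ x hx]
  have hG0 : ∀ x ∉ K, G x = 0 := fun x hx => by simp [G, hp0 _ x hx]
  let D1 : EuclideanSpace ℝ (Fin n) → ℝ := fun x => (‖x‖ ^ n)⁻¹ *
    (cF' N β (Real.log ‖x‖) * v x ^ 2
      + 2 * (aF N β (Real.log ‖x‖) * bF N β (Real.log ‖x‖)) * v x * e x)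
  let D2 : EuclideanSpace ℝ (Fin n) → ℝ := fun x => (‖x‖ ^ n)⁻¹ *
    (2 * aF N β (Real.log ‖x‖) * e x * (X x - N * e x)
      + 2 * (-4 * β * (Real.log ‖x‖)⁻¹ ^ 2) * e x ^ 2 - (-4 * β * (Real.log ‖x‖)⁻¹ ^ 2) * G x)
  let D3 : EuclideanSpace ℝ (Fin n) → ℝ := fun x => (‖x‖ ^ n)⁻¹ *
    ((-8 * β * (Real.log ‖x‖)⁻¹ ^ 2) * (v x * X x + G x)
      + (-N * (-8 * β * (Real.log ‖x‖)⁻¹ ^ 2) + 16 * β * (Real.log ‖x‖)⁻¹ ^ 3) * v x * e x)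
  have hD1 : Integrable D1 ∧ ∫ x, D1 x = 0 := by
    refine divA1 hK hK' (M := fun t => Real.exp (-(n:ℝ) * t) * (aF N β t * bF N β t))
      (M' := fun t => Real.exp (-(n:ℝ) * t) * (cF' N β t - n * (aF N β t * bF N β t)))
      ((exp_smooth _).mul ((aF_smooth _ _).mul (bF_smooth _ _))) ?_ hv hv0 ?_ ?_
    · intro t ht
      have := (exp_deriv (-(n:ℝ)) t).mul ((aF_deriv N β ht).mul (bF_deriv N β ht))
      exact this.congr_deriv (by simp only [cF', Pi.mul_apply]; ring)
    · intro x hx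
      simp [D1, hv0 x hx]
    · intro x hx
      simp only [exp_log_norm (hK' x hx).1, D1, e]
      ring
  have hD2 : Integrable D2 ∧ ∫ x, D2 x = 0 := by
    refine divA2 hK hK' (M := fun t => Real.exp ((2 - (n:ℝ)) * t) * aF N β t)
      (M' := fun t => Real.exp ((2 - (n:ℝ)) * t) *
        (-4 * β * t⁻¹ ^ 2 + (2 - n) * aF N β t))
      ((exp_smooth _).mul (aF_smooth _ _)) ?_ hv hv0 ?_ ?_
    · intro t ht
      have := (exp_deriv (2 - (n:ℝ)) t).mul (aF_deriv N β ht)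
      exact this.congr_deriv (by ring)
    · intro x hx
      simp [D2, he0 x hx, hG0 x hx]
    · intro x hx
      have : 0 < ‖x‖ := norm_pos_iff.2 (hK' x hx).1
      simp only [exp_log_norm' (hK' x hx).1, D2, e, G, X, hN]
      field_simp
      ring
  have hD3 : Integrable D3 ∧ ∫ x, D3 x = 0 := by
    refine divA3 hK hK' (M := fun t => Real.exp ((2 - (n:ℝ)) * t) * (-8 * β * t⁻¹ ^ 2))
      (M' := fun t => Real.exp ((2 - (n:ℝ)) * t) *
        (16 * β * t⁻¹ ^ 3 + (2 - n) * (-8 * β * t⁻¹ ^ 2)))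
      ((exp_smooth _).mul (contDiffOn_const.mul (inv_smooth.pow 2))) ?_ hv hv0 ?_ ?_
    · intro t ht
      have := (exp_deriv (2 - (n:ℝ)) t).mul ((ssq_deriv ht).const_mul (-8 * β))
      exact this.congr_deriv (by ring)
    · intro x hx
      simp [D3, hv0 x hx, hG0 x hx]
    · intro x hx
      have : 0 < ‖x‖ := norm_pos_iff.2 (hK' x hx).1
      simp only [exp_log_norm' (hK' x hx).1, D3, e, G, X, hN]
      field_simp
      ring
  let R : EuclideanSpace ℝ (Fin n) → ℝ := fun x =>
    (PhiW β (Real.log ‖x‖)) ^ 2 * (‖x‖ ^ n)⁻¹ * ‖x‖ ^ 4 * (lapl n u x) ^ 2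
  have hlap : ContDiff ℝ (⊤ : ℕ∞) (lapl n u) :=
    ContDiff.sum fun j _ => contDiff_pdir (contDiff_pdir hu)
  have hlap0 : ∀ x ∉ K, lapl n u x = 0 := fun x hx =>
    Finset.sum_eq_zero fun j _ => pdir_zero_off hK (pdir_zero_off hK hu0) x hx
  have hR : Integrable R := by
    have hcd : ContDiff ℝ 0 (fun x : EuclideanSpace ℝ (Fin n) =>
        (fun t => PhiW β t ^ 2 * Real.exp (-(n:ℝ) * t)) (Real.log ‖x‖)
          * (‖x‖ ^ 4 * lapl n u x ^ 2)) := by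
      refine contDiff_radial_mul hK hK' (((Phi_smooth β).pow 2).mul (exp_smooth _)) ?_ ?_
      · rw [contDiff_zero]
        exact (continuous_norm.pow 4).mul (hlap.continuous.pow 2)
      · intro x hx
        simp [hlap0 x hx]
    have hRe : R = fun x : EuclideanSpace ℝ (Fin n) =>
        (fun t => PhiW β t ^ 2 * Real.exp (-(n:ℝ) * t)) (Real.log ‖x‖)
          * (‖x‖ ^ 4 * lapl n u x ^ 2) := by
      funext x
      by_cases hx : x ∈ K
      · simp only [R, exp_log_norm (hK' x hx).1]; ring
      · simp [R, hlap0 x hx]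
    rw [hRe]
    refine hcd.continuous.integrable_of_hasCompactSupport (HasCompactSupport.intro hK ?_)
    intro x hx
    simp [hlap0 x hx]
  have hint : ∫ x, 3 * (R x - D2 x - D1 x - D3 x) = 3 * ∫ x, R x := by
    have s1 : Integrable (fun x => R x - D2 x) := hR.sub hD2.1
    have s2 : Integrable (fun x => R x - D2 x - D1 x) := s1.sub hD1.1
    rw [integral_const_mul, integral_sub s2 hD3.1, integral_sub s1 hD1.1, integral_sub hR hD2.1, hD1.2, hD2.2, hD3.2]
    simp
  have hI : Integrable fun x => 3 * (R x - D2 x - D1 x - D3 x) :=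
    (((hR.sub hD2.1).sub hD1.1).sub hD3.1).const_mul 3
  change _ ≤ 3 * ∫ x, R x
  rw [← hint, ← integral_const_mul]
  refine integral_mono_of_nonneg (Filter.Eventually.of_forall fun x => ?_) hI
    (Filter.Eventually.of_forall fun x => ?_)
  · simp only [Pi.zero_apply]
    positivity
  by_cases hx : x ∈ K
  swap
  · have hfd : ‖fderiv ℝ u x‖ ^ 2 = 0 := by
      rw [norm_fderiv_sq]
      exact Finset.sum_eq_zero fun j _ => by simp [pdir_zero_off hK hu0 x hx]
    simp [hfd, hu0 x hx, R, D1, D2, D3, hlap0 x hx, hv0 x hx, he0 x hx, hG0 x hx]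
  obtain ⟨hx0, hx1⟩ := hK' x hx
  have hnx : 0 < ‖x‖ := norm_pos_iff.2 hx0
  have ht8 : Real.log ‖x‖ < -8 := by
    rw [Real.log_lt_iff_lt_exp hnx]
    exact (hKt x hx).2
  have hs0 : (Real.log ‖x‖)⁻¹ < 0 := inv_lt_zero.2 (by linarith)
  have hs : -(1/8) ≤ (Real.log ‖x‖)⁻¹ := by
    rw [show -(1/8 : ℝ) = (-8)⁻¹ by norm_num]
    exact (inv_le_inv_of_neg (by norm_num) (by linarith)).2 ht8.le
  have hGe : e x ^ 2 ≤ G x := by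
    simp only [e, G]
    rw [EuclideanSpace.real_norm_sq_eq]
    exact Finset.sum_mul_sq_le_sq_mul_sq _ _ _
  have key := alg (v := v x) (X := X x) hβ hs hs0 hN0 hGe (κ := kapF β (Real.log ‖x‖)) rfl
    (a := aF N β (Real.log ‖x‖)) rfl (b := bF N β (Real.log ‖x‖)) rfl rfl
    (c' := cF' N β (Real.log ‖x‖)) rfl
  -- gradient identity
  have hp : ∀ j, pdir n j v x = PhiW β (Real.log ‖x‖) *
        (pdir n j u x - kapF β (Real.log ‖x‖) / ‖x‖ ^ 2 * x j * u x) := fun j =>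
    conj1 hu hx0 hx1 j
  have hee : e x = PhiW β (Real.log ‖x‖) * ((∑ j, x j * pdir n j u x)
      - kapF β (Real.log ‖x‖) * u x) := by
    have : ∀ j, x j * pdir n j v x = PhiW β (Real.log ‖x‖) * (x j * pdir n j u x)
        - PhiW β (Real.log ‖x‖) * kapF β (Real.log ‖x‖) / ‖x‖ ^ 2 * u x * (x j ^ 2) := by
      intro j; rw [hp]; ring
    simp only [e, this]
    rw [Finset.sum_sub_distrib, ← Finset.mul_sum, ← Finset.mul_sum,
      ← EuclideanSpace.real_norm_sq_eq]
    field_simp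
  have hgrad : PhiW β (Real.log ‖x‖) ^ 2 * (‖x‖ ^ 2 * ‖fderiv ℝ u x‖ ^ 2)
      = G x + 2 * kapF β (Real.log ‖x‖) * v x * e x + kapF β (Real.log ‖x‖) ^ 2 * v x ^ 2 := by
    rw [norm_fderiv_sq]
    have : ∀ j, PhiW β (Real.log ‖x‖) ^ 2 * ‖x‖ ^ 2 * pdir n j u x ^ 2
        = ‖x‖ ^ 2 * pdir n j v x ^ 2 + 2 * kapF β (Real.log ‖x‖) * v x * (x j * pdir n j v x)
          + kapF β (Real.log ‖x‖) ^ 2 * v x ^ 2 / ‖x‖ ^ 2 * x j ^ 2 := by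
      intro j
      have h : PhiW β (Real.log ‖x‖) * pdir n j u x
          = pdir n j v x + kapF β (Real.log ‖x‖) / ‖x‖ ^ 2 * x j * v x := by
        rw [hp]; simp only [hvdef]; ring
      have h2 : PhiW β (Real.log ‖x‖) ^ 2 * ‖x‖ ^ 2 * pdir n j u x ^ 2
          = ‖x‖ ^ 2 * (PhiW β (Real.log ‖x‖) * pdir n j u x) ^ 2 := by ring
      rw [h2, h]
      field_simp
      ring
    rw [← mul_assoc, Finset.mul_sum]
    simp only [this]
    rw [Finset.sum_add_distrib, Finset.sum_add_distrib, ← Finset.mul_sum, ← Finset.mul_sum,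
      ← Finset.mul_sum, ← EuclideanSpace.real_norm_sq_eq]
    simp only [G, e]
    field_simp
  have hP : PhiW β (Real.log ‖x‖) * (‖x‖ ^ 2 * lapl n u x)
      = X x + 2 * kapF β (Real.log ‖x‖) * e x + bF N β (Real.log ‖x‖) * v x := by
    have h2 : X x = _ := conj2 (β := β) hu hx0 hx1
    rw [h2, hee]
    simp only [bF, hvdef, kapF, hN]
    ring
  have hRx : R x = (‖x‖ ^ n)⁻¹ *
      (X x + 2 * kapF β (Real.log ‖x‖) * e x + bF N β (Real.log ‖x‖) * v x) ^ 2 := by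
    rw [← hP]; simp only [R]; ring
  have hLx : β * (PhiW β (Real.log ‖x‖) ^ 2 * ((Real.log ‖x‖) ^ 2)⁻¹ * (‖x‖ ^ n)⁻¹ *
              (‖x‖ ^ 2 * ‖fderiv ℝ u x‖ ^ 2 + (u x) ^ 2))
      = (‖x‖ ^ n)⁻¹ * (β * (Real.log ‖x‖)⁻¹ ^ 2 * ((G x + 2 * kapF β (Real.log ‖x‖) * v x * e x
        + kapF β (Real.log ‖x‖) ^ 2 * v x ^ 2) + v x ^ 2)) := by
    rw [← hgrad, inv_pow]; simp only [hvdef]; ring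
  have hq : 0 ≤ (‖x‖ ^ n)⁻¹ := by positivity
  have := mul_le_mul_of_nonneg_left key hq
  change β * (PhiW β (Real.log ‖x‖) ^ 2 * ((Real.log ‖x‖) ^ 2)⁻¹ * (‖x‖ ^ n)⁻¹ *
              (‖x‖ ^ 2 * ‖fderiv ℝ u x‖ ^ 2 + (u x) ^ 2)) ≤ 3 * (R x - D2 x - D1 x - D3 x)
  rw [hLx, hRx]
  refine this.trans (le_of_eq ?_)
  simp only [D1, D2, D3]
  ring

end helpers4

/-- **Lemma 2.1 (first Carleman estimate).** There exist `r₀ > 0` small, `β₀ > 1`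
large and `C > 0`, all depending only on `n`, such that for every
`u ∈ C₀^∞(ℝⁿ \ {0})` supported in `B_{r₀}` and every `β ≥ β₀`:
`β ∫ φ_β² (log|x|)⁻² |x|⁻ⁿ (|x|²|∇u|² + |u|²) ≤ C ∫ φ_β² |x|⁻ⁿ |x|⁴ |Δu|²`. -/
theorem carleman_estimate_one (n : ℕ) (hn : 2 ≤ n) :
    ∃ r₀ : ℝ, 0 < r₀ ∧ ∃ β₀ : ℝ, 1 < β₀ ∧ ∃ C : ℝ, 0 < C ∧
      ∀ u : EuclideanSpace ℝ (Fin n) → ℝ,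
        ContDiff ℝ (⊤ : ℕ∞) u → HasCompactSupport u →
        tsupport u ⊆ Metric.ball (0 : EuclideanSpace ℝ (Fin n)) r₀ →
        (0 : EuclideanSpace ℝ (Fin n)) ∉ tsupport u →
      ∀ β : ℝ, β₀ ≤ β →
        β * ∫ x : EuclideanSpace ℝ (Fin n),
            (carlemanWt β ‖x‖) ^ 2 * ((Real.log ‖x‖) ^ 2)⁻¹ * (‖x‖ ^ n)⁻¹ *
              (‖x‖ ^ 2 * ‖fderiv ℝ u x‖ ^ 2 + (u x) ^ 2) ≤
        C * ∫ x : EuclideanSpace ℝ (Fin n),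
            (carlemanWt β ‖x‖) ^ 2 * (‖x‖ ^ n)⁻¹ * ‖x‖ ^ 4 * (lapl n u x) ^ 2 := by
  exact ⟨Real.exp (-8), Real.exp_pos _, 2, by norm_num, 3, by norm_num,
    fun u hu hc hb h0 β hβ => main_est hn hu hc hb h0 hβ⟩
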